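/- There exist universal constants c > 0 and C > 0 with the following property: for all integers k, m with C ≤ k ≤ m, if A is an m×k random matrix with independent standard Gaussian entries, then P{s_max(A) ≤ √m + c√k} ≤ 1/16 and P{s_min(A) ≥ √m − c√k} ≤ 1/16, where s_max(A) and s_min(A) denote the largest and smallest singular values of A. -/

import Mathlib

open MeasureTheory ProbabilityTheory

noncomputable section

/-- The largest singular value of an `m × k` real matrix:
`s_max(A) = sup{‖Ax‖₂ : ‖x‖₂ = 1}`. -/
def sMax {m k : ℕ} (A : Matrix (Fin m) (Fin k) ℝ) : ℝ :=
  sSup {t : ℝ | ∃ x : Fin k → ℝ, ∑ j, x j ^ 2 = 1 ∧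
    t = Real.sqrt (∑ i, (A.mulVec x i) ^ 2)}

/-- The smallest singular value of an `m × k` real matrix:
`s_min(A) = inf{‖Ax‖₂ : ‖x‖₂ = 1}`. -/
def sMin {m k : ℕ} (A : Matrix (Fin m) (Fin k) ℝ) : ℝ :=
  sInf {t : ℝ | ∃ x : Fin k → ℝ, ∑ j, x j ^ 2 = 1 ∧
    t = Real.sqrt (∑ i, (A.mulVec x i) ^ 2)}

open scoped Matrix

/-- Transposing a finite array of i.i.d. entries preserves its law. -/
lemma measurePreserving_pi_transpose {ι κ α : Type*} [Fintype ι] [Fintype κ] [MeasurableSpace α]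
    (μ : Measure α) [IsProbabilityMeasure μ] :
    MeasurePreserving (fun (f : ι → κ → α) (j : κ) (i : ι) => f i j)
      (Measure.pi fun _ : ι => Measure.pi fun _ : κ => μ)
      (Measure.pi fun _ : κ => Measure.pi fun _ : ι => μ) := by
  have hmeas : Measurable (fun (f : ι → κ → α) (j : κ) (i : ι) => f i j) := by fun_prop
  refine ⟨hmeas, Eq.symm ?_⟩
  refine Measure.pi_eq_generateFrom (C := fun _ => Set.pi Set.univ ''
      Set.pi Set.univ fun _ : ι => {s : Set α | MeasurableSet s})
    (fun _ => generateFrom_pi) (fun _ => isPiSystem_pi)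
    (fun _ => Measure.FiniteSpanningSetsIn.pi fun _ => μ.toFiniteSpanningSetsIn) ?_
  intro s hs
  choose t ht hts using hs
  obtain rfl : (fun j => Set.univ.pi (t j)) = s := funext hts
  have hpre : (fun (f : ι → κ → α) (j : κ) (i : ι) => f i j) ⁻¹'
      Set.univ.pi (fun j => Set.univ.pi (t j)) =
      Set.univ.pi fun i => Set.univ.pi fun j => t j i := by
    ext f
    simp only [Set.mem_preimage, Set.mem_univ_pi]
    exact forall_comm
  rw [Measure.map_apply hmeas, hpre]
  · simp only [Measure.pi_pi]
    exact Finset.prod_comm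
  · exact MeasurableSet.univ_pi fun j => MeasurableSet.univ_pi fun i => ht j i (Set.mem_univ i)

/-- Chebyshev's inequality for the squared norm of a standard Gaussian vector. -/
lemma exists_gaussian_sq_sum_tail_bound :
    ∃ K : ℝ, 0 < K ∧ ∀ (n : ℕ) (t : ℝ), 0 < t →
      (Measure.pi fun _ : Fin n => gaussianReal 0 1)
        {x : Fin n → ℝ | t ≤ |∑ i, x i ^ 2 - n|} ≤ ENNReal.ofReal (K * n / t ^ 2) := by
  have hL : MemLp (fun x : ℝ => x ^ 2) 2 (gaussianReal 0 1) := by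
    have h4 : MemLp (id : ℝ → ℝ) 4 (gaussianReal 0 1) := memLp_id_gaussianReal' 4 (by simp)
    have := MemLp.norm_rpow_div h4 2
    have h42 : (4 : ENNReal) / 2 = 2 := by
      rw [show (4 : ENNReal) = 2 * 2 by norm_num, ENNReal.mul_div_cancel_right] <;> simp
    rw [h42] at this
    simpa using this
  have hE : ∫ x : ℝ, x ^ 2 ∂gaussianReal 0 1 = 1 := by
    have := variance_eq_sub (IsGaussian.memLp_two_id (μ := gaussianReal 0 1))
    rw [variance_id_gaussianReal] at this
    simpa [integral_id_gaussianReal] using this.symm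
  refine ⟨Var[fun x : ℝ => x ^ 2; gaussianReal 0 1] + 1,
    by linarith [variance_nonneg (fun x : ℝ => x ^ 2) (gaussianReal 0 1)], fun n t ht => ?_⟩
  set P := Measure.pi fun _ : Fin n => gaussianReal 0 1
  have hLi (i : Fin n) : MemLp (fun x : Fin n → ℝ => x i ^ 2) 2 P :=
    hL.comp_measurePreserving (measurePreserving_eval (fun _ : Fin n => gaussianReal 0 1) i)
  have hX : MemLp (∑ i : Fin n, fun x : Fin n → ℝ => x i ^ 2) 2 P :=
    memLp_finsetSum' _ fun i _ => hLi i
  have hEi (i : Fin n) : ∫ x : Fin n → ℝ, x i ^ 2 ∂P = 1 := by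
    have he := measurePreserving_eval (fun _ : Fin n => gaussianReal 0 1) i
    rw [← hE, ← he.map_eq, integral_map he.aemeasurable (by fun_prop)]
  have hEX : ∫ x, (∑ i : Fin n, fun x : Fin n → ℝ => x i ^ 2) x ∂P = n := by
    simp only [Finset.sum_apply]
    rw [integral_finsetSum _ fun i _ => (hLi i).integrable (by norm_num)]
    simp [hEi]
  have hV := variance_sum_pi (μ := fun _ : Fin n => gaussianReal 0 1)
    (X := fun _ x => x ^ 2) fun _ => hL
  have h := meas_ge_le_variance_div_sq hX ht
  rw [hEX, hV] at h
  simp only [Finset.sum_apply, Finset.sum_const, Finset.card_univ, Fintype.card_fin,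
    nsmul_eq_mul] at h
  refine h.trans (ENNReal.ofReal_le_ofReal ?_)
  rw [mul_comm (n : ℝ)]
  gcongr
  linarith

/-- The linear reflection of `ℝⁿ` in the hyperplane orthogonal to `w`. -/
def householder {n : ℕ} (w : Fin n → ℝ) : (Fin n → ℝ) →ₗ[ℝ] (Fin n → ℝ) where
  toFun y := y - (2 * (w ⬝ᵥ y) / (w ⬝ᵥ w)) • w
  map_add' x y := by rw [dotProduct_add, mul_add, add_div, add_smul]; abel
  map_smul' c y := by
    rw [dotProduct_smul, smul_sub, smul_smul, smul_eq_mul, RingHom.id_apply]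
    ring_nf

lemma householder_apply {n : ℕ} (w y : Fin n → ℝ) :
    householder w y = y - (2 * (w ⬝ᵥ y) / (w ⬝ᵥ w)) • w := rfl

lemma toLp_householder {n : ℕ} (w y : Fin n → ℝ) :
    WithLp.toLp 2 (householder w y) =
      (ℝ ∙ (WithLp.toLp 2 w : EuclideanSpace ℝ (Fin n)))ᗮ.reflection (WithLp.toLp 2 y) := by
  rw [Submodule.reflection_orthogonal_apply, Submodule.reflection_singleton_apply,
    householder_apply]
  have hn : ‖(WithLp.toLp 2 w : EuclideanSpace ℝ (Fin n))‖ ^ 2 = w ⬝ᵥ w := by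
    rw [← real_inner_self_eq_norm_sq, EuclideanSpace.inner_toLp_toLp]; simp
  have hi : inner ℝ (WithLp.toLp 2 w : EuclideanSpace ℝ (Fin n)) (WithLp.toLp 2 y) = w ⬝ᵥ y := by
    rw [EuclideanSpace.inner_toLp_toLp, dotProduct_comm]; simp
  simp only [RCLike.ofReal_real_eq_id, id_eq, hn, hi]
  ext i
  simp
  ring

lemma householder_dotProduct {n : ℕ} (w x y : Fin n → ℝ) :
    householder w x ⬝ᵥ householder w y = x ⬝ᵥ y := by
  have h := LinearIsometryEquiv.inner_map_map
    ((ℝ ∙ (WithLp.toLp 2 w : EuclideanSpace ℝ (Fin n)))ᗮ.reflection) (WithLp.toLp 2 y)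
    (WithLp.toLp 2 x)
  rw [← toLp_householder, ← toLp_householder, EuclideanSpace.inner_toLp_toLp,
    EuclideanSpace.inner_toLp_toLp] at h
  simpa using h

lemma householder_sub_apply {n : ℕ} {x y : Fin n → ℝ} (h : x ⬝ᵥ x = y ⬝ᵥ y) :
    householder (x - y) y = x := by
  by_cases hw : (x - y) ⬝ᵥ (x - y) = 0
  · rw [dotProduct_self_eq_zero, sub_eq_zero] at hw
    simp [hw, householder_apply]
  · have h2 : 2 * ((x - y) ⬝ᵥ y) = -((x - y) ⬝ᵥ (x - y)) := by
      simp only [sub_dotProduct, dotProduct_sub, h, dotProduct_comm y x]; ring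
    rw [householder_apply, h2, neg_div, div_self hw]
    simp

lemma measurePreserving_householder {n : ℕ} (w : Fin n → ℝ) :
    MeasurePreserving (householder w) (Measure.pi fun _ : Fin n => gaussianReal 0 1)
      (Measure.pi fun _ : Fin n => gaussianReal 0 1) := by
  have hL : MeasurePreserving (WithLp.toLp 2 : (Fin n → ℝ) → EuclideanSpace ℝ (Fin n))
      (Measure.pi fun _ : Fin n => gaussianReal 0 1) (stdGaussian _) :=
    ⟨by fun_prop, map_pi_eq_stdGaussian⟩
  have hR : MeasurePreserving ((ℝ ∙ (WithLp.toLp 2 w : EuclideanSpace ℝ (Fin n)))ᗮ.reflection)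
      (stdGaussian _) (stdGaussian _) :=
    ⟨by fun_prop, stdGaussian_map _⟩
  have hS := hL.symm (MeasurableEquiv.toLp 2 (Fin n → ℝ))
  convert (hS.comp hR).comp hL using 1
  ext1 y
  simp [← toLp_householder]

lemma measurable_householder {n : ℕ} :
    Measurable fun p : (Fin n → ℝ) × (Fin n → ℝ) => householder p.1 p.2 := by
  simp only [householder_apply, dotProduct]
  fun_prop

/-- A reflection of `ℝⁿ⁺¹` taking the first coordinate axis to the line spanned by `a`. -/
def axisReflection {n : ℕ} (a : Fin (n + 1) → ℝ) :
    (Fin (n + 1) → ℝ) →ₗ[ℝ] (Fin (n + 1) → ℝ) :=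
  householder (a - Pi.single 0 (Real.sqrt (a ⬝ᵥ a)))

lemma dotProduct_self_nonneg_real {n : ℕ} (a : Fin n → ℝ) : 0 ≤ a ⬝ᵥ a :=
  Finset.sum_nonneg fun i _ => mul_self_nonneg (a i)

lemma axisReflection_single {n : ℕ} (a : Fin (n + 1) → ℝ) :
    axisReflection a (Pi.single 0 (Real.sqrt (a ⬝ᵥ a))) = a := by
  refine householder_sub_apply ?_
  rw [dotProduct_single, Pi.single_eq_same,
    Real.mul_self_sqrt (dotProduct_self_nonneg_real a)]

lemma axisReflection_dotProduct {n : ℕ} (a x y : Fin (n + 1) → ℝ) :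
    axisReflection a x ⬝ᵥ axisReflection a y = x ⬝ᵥ y :=
  householder_dotProduct _ x y

lemma measurePreserving_axisReflection {n : ℕ} (a : Fin (n + 1) → ℝ) :
    MeasurePreserving (axisReflection a) (Measure.pi fun _ => gaussianReal 0 1)
      (Measure.pi fun _ => gaussianReal 0 1) :=
  measurePreserving_householder _

lemma measurable_axisReflection {n : ℕ} :
    Measurable fun p : (Fin (n + 1) → ℝ) × (Fin (n + 1) → ℝ) => axisReflection p.1 p.2 := by
  have h : Measurable fun a : Fin (n + 1) → ℝ =>
      a - (Pi.single 0 (Real.sqrt (a ⬝ᵥ a)) : Fin (n + 1) → ℝ) := by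
    refine measurable_id.sub (measurable_pi_iff.2 fun i => ?_)
    simp only [Pi.single_apply, dotProduct]
    split_ifs <;> fun_prop
  have h' := measurable_householder.comp ((h.comp measurable_fst).prodMk measurable_snd)
  simpa only [Function.comp_def, axisReflection] using h'

/-- Reflecting every vector of a Gaussian family along an independent vector gives a Gaussian
family independent of that vector. -/
lemma measurePreserving_axisReflection_pi {n q : ℕ} :
    MeasurePreserving
      (fun p : (Fin (n + 1) → ℝ) × (Fin q → Fin (n + 1) → ℝ) =>
        (p.1, fun i => axisReflection p.1 (p.2 i)))
      ((Measure.pi fun _ => gaussianReal 0 1).prod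
        (Measure.pi fun _ => Measure.pi fun _ => gaussianReal 0 1))
      ((Measure.pi fun _ => gaussianReal 0 1).prod
        (Measure.pi fun _ => Measure.pi fun _ => gaussianReal 0 1)) := by
  refine MeasurePreserving.skew_product (f := id) (MeasurePreserving.id _)
    (g := fun (a : Fin (n + 1) → ℝ) (M : Fin q → Fin (n + 1) → ℝ) i => axisReflection a (M i))
    ?_ (Filter.Eventually.of_forall fun a => ?_)
  · have hi (i : Fin q) : Measurable
        fun p : (Fin (n + 1) → ℝ) × (Fin q → Fin (n + 1) → ℝ) => (p.1, p.2 i) := by fun_prop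
    refine measurable_pi_iff.2 fun i => ?_
    have h := measurable_axisReflection.comp (hi i)
    simpa only [Function.comp_def, Function.uncurry] using h
  · exact (measurePreserving_pi _ _ fun _ => measurePreserving_axisReflection a).map_eq

lemma measurePreserving_fin_cons {α : Type*} [MeasurableSpace α] (μ : Measure α) [SigmaFinite μ]
    (n : ℕ) :
    MeasurePreserving (fun p : α × (Fin n → α) => (Fin.cons p.1 p.2 : Fin (n + 1) → α))
      (μ.prod (Measure.pi fun _ => μ)) (Measure.pi fun _ => μ) := by
  have h := (measurePreserving_piFinSuccAbove (fun _ : Fin (n + 1) => μ) 0).symm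
  convert h using 1
  ext1 p
  simp [MeasurableEquiv.piFinSuccAbove, Fin.consEquiv]

/-- The matrix with first row `r` whose remaining rows are those of `H` reflected along `r`. -/
def rowAligned {m n : ℕ} (r : Fin (n + 1) → ℝ) (H : Fin m → Fin (n + 1) → ℝ) :
    Fin (m + 1) → Fin (n + 1) → ℝ :=
  Fin.cons r fun i => axisReflection r (H i)

/-- The matrix with first column `a` whose remaining columns are those of the row-aligned matrix
of `r` and `H`, reflected along `a`. -/
def alignedMatrix {m n : ℕ}
    (p : (Fin (m + 1) → ℝ) × (Fin (n + 1) → ℝ) × (Fin m → Fin (n + 1) → ℝ)) :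
    Fin (m + 1) → Fin (n + 2) → ℝ :=
  fun i j => (Fin.cons p.1 fun j' => axisReflection p.1 fun l => rowAligned p.2.1 p.2.2 l j' :
    Fin (n + 2) → Fin (m + 1) → ℝ) j i

lemma measurePreserving_alignedMatrix (m n : ℕ) :
    MeasurePreserving (alignedMatrix (m := m) (n := n))
      ((Measure.pi fun _ => gaussianReal 0 1).prod ((Measure.pi fun _ => gaussianReal 0 1).prod
        (Measure.pi fun _ => Measure.pi fun _ => gaussianReal 0 1)))
      (Measure.pi fun _ => Measure.pi fun _ => gaussianReal 0 1) := by
  have hrow : MeasurePreserving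
      (fun p : (Fin (n + 1) → ℝ) × (Fin m → Fin (n + 1) → ℝ) =>
        fun (j : Fin (n + 1)) (l : Fin (m + 1)) => rowAligned p.1 p.2 l j)
      ((Measure.pi fun _ => gaussianReal 0 1).prod
        (Measure.pi fun _ => Measure.pi fun _ => gaussianReal 0 1))
      (Measure.pi fun _ => Measure.pi fun _ => gaussianReal 0 1) :=
    (measurePreserving_pi_transpose (gaussianReal 0 1)).comp
      ((measurePreserving_fin_cons _ m).comp measurePreserving_axisReflection_pi)
  exact (measurePreserving_pi_transpose (gaussianReal 0 1)).comp
    ((measurePreserving_fin_cons _ (n + 1)).comp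
      (measurePreserving_axisReflection_pi.comp ((MeasurePreserving.id _).prod hrow)))

/-- The vector with first entry `1` followed by `σ` times the direction of `r`, once normalized,
has an image under the aligned matrix whose norm is explicit. -/
lemma exists_unit_mulVec_alignedMatrix {m n : ℕ} (a : Fin (m + 1) → ℝ) (r : Fin (n + 1) → ℝ)
    (H : Fin m → Fin (n + 1) → ℝ) (hr : 0 < r ⬝ᵥ r) {σ : ℝ} (hσ : σ ^ 2 = 1) :
    ∃ x : Fin (n + 2) → ℝ, ∑ j, x j ^ 2 = 1 ∧
      ∑ i, ((Matrix.of (alignedMatrix (a, r, H))).mulVec x i) ^ 2 =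
        ((Real.sqrt (a ⬝ᵥ a) + σ * Real.sqrt (r ⬝ᵥ r)) ^ 2 + ∑ i, H i 0 ^ 2) / 2 := by
  set p := Real.sqrt (a ⬝ᵥ a) with hp
  set q := Real.sqrt (r ⬝ᵥ r) with hq
  have hq0 : 0 < q := Real.sqrt_pos.2 hr
  have hqq : q * q = r ⬝ᵥ r := Real.mul_self_sqrt hr.le
  set τ := (Real.sqrt 2)⁻¹ with hτ
  have hττ : τ ^ 2 = 1 / 2 := by rw [hτ, inv_pow, Real.sq_sqrt (by norm_num)]; norm_num
  set z : Fin (m + 1) → ℝ := Fin.cons (p + σ * q) fun i => σ * H i 0 with hz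
  have hrow (l : Fin (m + 1)) :
      Pi.single (M := fun _ => ℝ) 0 p l + (σ / q) * (rowAligned r H l ⬝ᵥ r) = z l := by
    refine Fin.cases ?_ (fun i => ?_) l
    · simp only [rowAligned, Fin.cons_zero, hz, Pi.single_eq_same, ← hqq]
      field_simp
    · have hdot : axisReflection r (H i) ⬝ᵥ r = H i 0 * q := by
        have h := axisReflection_dotProduct r (H i) (Pi.single 0 q)
        rwa [axisReflection_single, dotProduct_single] at h
      simp only [rowAligned, Fin.cons_succ, hz, hdot,
        Pi.single_eq_of_ne (Fin.succ_ne_zero i), zero_add]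
      field_simp
  refine ⟨Fin.cons τ fun j => τ * (σ / q) * r j, ?_, ?_⟩
  · have hs : ∑ j, (τ * (σ / q) * r j) ^ 2 = (τ * (σ / q)) ^ 2 * (r ⬝ᵥ r) := by
      rw [dotProduct, Finset.mul_sum]
      exact Finset.sum_congr rfl fun j _ => by ring
    rw [Fin.sum_univ_succ]
    simp only [Fin.cons_zero, Fin.cons_succ]
    rw [hs, ← hqq, mul_pow, div_pow, hσ, hττ]
    field_simp
    norm_num
  · have hmul : (Matrix.of (alignedMatrix (a, r, H))).mulVec
        (Fin.cons τ fun j => τ * (σ / q) * r j) = axisReflection a (τ • z) := by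
      have hzs : τ • z = τ • (Pi.single 0 p : Fin (m + 1) → ℝ) +
          ∑ j, (τ * (σ / q) * r j) • fun l => rowAligned r H l j := by
        ext l
        simp only [Pi.smul_apply, Pi.add_apply, Finset.sum_apply, smul_eq_mul, ← hrow l,
          dotProduct, mul_add, Finset.mul_sum]
        congr 1
        exact Finset.sum_congr rfl fun j _ => by ring
      rw [hzs, map_add, map_smul, map_sum, axisReflection_single]
      ext i
      simp only [Matrix.mulVec, dotProduct, Fin.sum_univ_succ, Matrix.of_apply, alignedMatrix,
        Fin.cons_zero, Fin.cons_succ, Pi.add_apply, Pi.smul_apply, Finset.sum_apply, map_smul,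
        smul_eq_mul]
      simp only [mul_comm]
    have hsq (v : Fin (m + 1) → ℝ) : ∑ i, v i ^ 2 = v ⬝ᵥ v :=
      Finset.sum_congr rfl fun i _ => sq (v i)
    rw [hmul, hsq, axisReflection_dotProduct, ← hsq, Fin.sum_univ_succ]
    simp only [hz, Pi.smul_apply, smul_eq_mul, Fin.cons_zero, Fin.cons_succ, mul_pow, hττ, hσ,
      one_mul, ← Finset.mul_sum]
    ring

lemma sum_mulVec_sq_le {m k : ℕ} (A : Matrix (Fin m) (Fin k) ℝ) {x : Fin k → ℝ}
    (hx : ∑ j, x j ^ 2 = 1) : ∑ i, (A.mulVec x i) ^ 2 ≤ ∑ i, ∑ j, A i j ^ 2 := by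
  refine Finset.sum_le_sum fun i _ => ?_
  have h := Finset.sum_mul_sq_le_sq_mul_sq Finset.univ (A i) x
  rwa [hx, mul_one] at h

lemma exists_sum_sq_eq_one (k : ℕ) : ∃ x : Fin (k + 1) → ℝ, ∑ j, x j ^ 2 = 1 :=
  ⟨Pi.single 0 1, by simp [Fin.sum_univ_succ]⟩

lemma sMax_le_iff {m k : ℕ} (A : Matrix (Fin m) (Fin (k + 1)) ℝ) (t : ℝ) :
    sMax A ≤ t ↔ ∀ x : Fin (k + 1) → ℝ, ∑ j, x j ^ 2 = 1 →
      Real.sqrt (∑ i, (A.mulVec x i) ^ 2) ≤ t := by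
  have hbdd : BddAbove {t : ℝ | ∃ x : Fin (k + 1) → ℝ, ∑ j, x j ^ 2 = 1 ∧
      t = Real.sqrt (∑ i, (A.mulVec x i) ^ 2)} := by
    refine ⟨Real.sqrt (∑ i, ∑ j, A i j ^ 2), ?_⟩
    rintro _ ⟨x, hx, rfl⟩
    exact Real.sqrt_le_sqrt (sum_mulVec_sq_le A hx)
  obtain ⟨x₀, hx₀⟩ := exists_sum_sq_eq_one k
  rw [sMax, csSup_le_iff hbdd ⟨_, x₀, hx₀, rfl⟩]
  exact ⟨fun h x hx => h _ ⟨x, hx, rfl⟩, by rintro h _ ⟨x, hx, rfl⟩; exact h x hx⟩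

lemma le_sMin_iff {m k : ℕ} (A : Matrix (Fin m) (Fin (k + 1)) ℝ) (t : ℝ) :
    t ≤ sMin A ↔ ∀ x : Fin (k + 1) → ℝ, ∑ j, x j ^ 2 = 1 →
      t ≤ Real.sqrt (∑ i, (A.mulVec x i) ^ 2) := by
  have hbdd : BddBelow {t : ℝ | ∃ x : Fin (k + 1) → ℝ, ∑ j, x j ^ 2 = 1 ∧
      t = Real.sqrt (∑ i, (A.mulVec x i) ^ 2)} := by
    refine ⟨0, ?_⟩
    rintro _ ⟨x, hx, rfl⟩
    exact Real.sqrt_nonneg _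
  obtain ⟨x₀, hx₀⟩ := exists_sum_sq_eq_one k
  rw [sMin, le_csInf_iff hbdd ⟨_, x₀, hx₀, rfl⟩]
  exact ⟨fun h x hx => h _ ⟨x, hx, rfl⟩, by rintro h _ ⟨x, hx, rfl⟩; exact h x hx⟩

lemma continuous_sqrt_sum_mulVec_sq {m k : ℕ} (x : Fin k → ℝ) :
    Continuous fun f : Fin m → Fin k → ℝ =>
      Real.sqrt (∑ i, ((Matrix.of f).mulVec x i) ^ 2) := by
  simp only [Matrix.mulVec, dotProduct, Matrix.of_apply]
  fun_prop

lemma measurableSet_sMax_le (m k : ℕ) (t : ℝ) :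
    MeasurableSet {f : Fin m → Fin (k + 1) → ℝ | sMax (Matrix.of f) ≤ t} := by
  simp only [sMax_le_iff, Set.ofPred_forall]
  exact (isClosed_iInter fun x => isClosed_iInter fun _ =>
    isClosed_le (continuous_sqrt_sum_mulVec_sq x) continuous_const).measurableSet

lemma measurableSet_le_sMin (m k : ℕ) (t : ℝ) :
    MeasurableSet {f : Fin m → Fin (k + 1) → ℝ | t ≤ sMin (Matrix.of f)} := by
  simp only [le_sMin_iff, Set.ofPred_forall]
  exact (isClosed_iInter fun x => isClosed_iInter fun _ =>
    isClosed_le continuous_const (continuous_sqrt_sum_mulVec_sq x)).measurableSet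

/-- If `α ≈ s²`, `ρ ≈ t²` and `β ≈ s²` up to small multiples of `st`, `t²` and `st`, then the norms
of the images of the two test vectors lie beyond `s + t/8` and `s - t/8`. -/
lemma sqrt_bounds_of_concentration {s t α ρ β : ℝ} (ht : 0 < t) (hts : t ≤ s) (ht2 : 64 ≤ t ^ 2)
    (hα : |α - s ^ 2| < s * t / 16) (hρ : |ρ - (t ^ 2 - 1)| < t ^ 2 / 32)
    (hβ : |β - (s ^ 2 - 1)| < s * t / 16) :
    s + 1 / 8 * t < Real.sqrt (((Real.sqrt α + Real.sqrt ρ) ^ 2 + β) / 2) ∧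
      Real.sqrt (((Real.sqrt α - Real.sqrt ρ) ^ 2 + β) / 2) < s - 1 / 8 * t := by
  rw [abs_lt] at hα hρ hβ
  have hs : 0 < s := ht.trans_le hts
  have hst : t ^ 2 ≤ s * t := by nlinarith
  have hss : s * t ≤ s ^ 2 := by nlinarith
  have hp : 15 / 16 * s ≤ Real.sqrt α := Real.le_sqrt_of_sq_le (by nlinarith)
  have hq : 15 / 16 * t ≤ Real.sqrt ρ := Real.le_sqrt_of_sq_le (by nlinarith)
  have hpp : Real.sqrt α ^ 2 = α := Real.sq_sqrt (by nlinarith)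
  have hqq : Real.sqrt ρ ^ 2 = ρ := Real.sq_sqrt (by nlinarith)
  have hpq : 225 / 256 * (s * t) ≤ Real.sqrt α * Real.sqrt ρ :=
    calc 225 / 256 * (s * t) = (15 / 16 * s) * (15 / 16 * t) := by ring
      _ ≤ _ := by gcongr
  constructor
  · refine Real.lt_sqrt_of_sq_lt ?_
    nlinarith
  · rw [Real.sqrt_lt' (by linarith)]
    nlinarith

lemma exists_concentration_bound :
    ∃ C : ℝ, 64 ≤ C ∧ ∀ m n : ℕ, C ≤ ((n + 2 : ℕ) : ℝ) →
      ((Measure.pi fun _ : Fin (m + 1) => gaussianReal 0 1).prod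
        ((Measure.pi fun _ : Fin (n + 1) => gaussianReal 0 1).prod
          (Measure.pi fun _ : Fin m => Measure.pi fun _ : Fin (n + 1) => gaussianReal 0 1)))
        {p | ¬ (|p.1 ⬝ᵥ p.1 - ((m + 1 : ℕ) : ℝ)| <
              Real.sqrt (m + 1 : ℕ) * Real.sqrt (n + 2 : ℕ) / 16 ∧
            |p.2.1 ⬝ᵥ p.2.1 - ((n + 1 : ℕ) : ℝ)| < ((n + 2 : ℕ) : ℝ) / 32 ∧
            |∑ i, p.2.2 i 0 ^ 2 - (m : ℝ)| <
              Real.sqrt (m + 1 : ℕ) * Real.sqrt (n + 2 : ℕ) / 16)} ≤ 1 / 16 := by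
  obtain ⟨K, hK, hcheb⟩ := exists_gaussian_sq_sum_tail_bound
  refine ⟨65536 * K + 64, by linarith, fun m n hC => ?_⟩
  set γm := Measure.pi fun _ : Fin (m + 1) => gaussianReal 0 1
  set γn := Measure.pi fun _ : Fin (n + 1) => gaussianReal 0 1
  set γH := Measure.pi fun _ : Fin m => Measure.pi fun _ : Fin (n + 1) => gaussianReal 0 1
  set δ := Real.sqrt (m + 1 : ℕ) * Real.sqrt (n + 2 : ℕ) / 16 with hδ
  set k : ℝ := ((n + 2 : ℕ) : ℝ) with hk
  have hk0 : 0 < k := by rw [hk]; positivity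
  have hm0 : (0 : ℝ) < ((m + 1 : ℕ) : ℝ) := by positivity
  have hδ0 : 0 < δ := by positivity
  have hδ2 : δ ^ 2 = ((m + 1 : ℕ) : ℝ) * k / 256 := by
    rw [hδ, div_pow, mul_pow, Real.sq_sqrt hm0.le, Real.sq_sqrt hk0.le]; norm_num
  have hsmall {x : ℝ} (hx : x ≤ 1024 * K / k) : ENNReal.ofReal x ≤ 1 / 48 := by
    have : x ≤ 1 / 48 := hx.trans (by rw [div_le_div_iff₀ hk0 (by norm_num)]; linarith)
    refine (ENNReal.ofReal_le_ofReal this).trans ?_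
    rw [ENNReal.ofReal_div_of_pos (by norm_num)]
    simp
  have hfst : MeasurePreserving Prod.fst (γm.prod (γn.prod γH)) γm := measurePreserving_fst
  have hmid : MeasurePreserving (fun p : (Fin (m + 1) → ℝ) × (Fin (n + 1) → ℝ) ×
      (Fin m → Fin (n + 1) → ℝ) => p.2.1) (γm.prod (γn.prod γH)) γn :=
    measurePreserving_fst.comp measurePreserving_snd
  have hlast : MeasurePreserving (fun p : (Fin (m + 1) → ℝ) × (Fin (n + 1) → ℝ) ×
      (Fin m → Fin (n + 1) → ℝ) => fun i => p.2.2 i 0) (γm.prod (γn.prod γH))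
      (Measure.pi fun _ : Fin m => gaussianReal 0 1) :=
    (measurePreserving_pi _ _ fun _ => measurePreserving_eval
      (fun _ : Fin (n + 1) => gaussianReal 0 1) 0).comp
      (measurePreserving_snd.comp measurePreserving_snd)
  have hms (q : ℕ) (c d : ℝ) : MeasurableSet {x : Fin q → ℝ | c ≤ |∑ i, x i ^ 2 - d|} :=
    measurableSet_le (by fun_prop) (by fun_prop)
  have h1 := (hfst.measure_preimage (hms _ δ (m + 1 : ℕ)).nullMeasurableSet).trans_le
    ((hcheb (m + 1) δ hδ0).trans (hsmall (by
      rw [hδ2, div_le_div_iff₀ (by positivity) hk0]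
      nlinarith [mul_pos (mul_pos hK hm0) hk0])))
  have h2 := (hmid.measure_preimage (hms _ (k / 32) (n + 1 : ℕ)).nullMeasurableSet).trans_le
    ((hcheb (n + 1) (k / 32) (by positivity)).trans (hsmall (by
      have : ((n + 1 : ℕ) : ℝ) ≤ k := by rw [hk]; push_cast; linarith
      rw [div_le_div_iff₀ (by positivity) hk0]
      nlinarith [mul_le_mul_of_nonneg_left this (mul_pos hK hk0).le])))
  have h3 := (hlast.measure_preimage (hms _ δ m).nullMeasurableSet).trans_le
    ((hcheb m δ hδ0).trans (hsmall (by
      have : (m : ℝ) ≤ ((m + 1 : ℕ) : ℝ) := by push_cast; linarith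
      rw [hδ2, div_le_div_iff₀ (by positivity) hk0]
      nlinarith [mul_le_mul_of_nonneg_left this (mul_pos hK hk0).le,
        mul_pos (mul_pos hK hm0) hk0])))
  have hsum : (1 / 48 : ENNReal) + (1 / 48 + 1 / 48) ≤ 1 / 16 := by
    rw [ENNReal.div_add_div_same, ENNReal.div_add_div_same,
      ENNReal.div_le_iff (by norm_num) (by norm_num), ← ENNReal.mul_div_right_comm,
      ENNReal.le_div_iff_mul_le (by norm_num) (by norm_num)]
    norm_num
  have hsq {q : ℕ} (x : Fin q → ℝ) : x ⬝ᵥ x = ∑ i, x i ^ 2 :=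
    Finset.sum_congr rfl fun i _ => (sq (x i)).symm
  refine (measure_mono ?_).trans ((measure_union_le _ _).trans
    ((add_le_add h1 ((measure_union_le _ _).trans (add_le_add h2 h3))).trans hsum))
  intro p hp
  simp only [Set.mem_ofPred_eq, not_and_or, not_lt, hsq] at hp
  exact hp

/-- **Extreme singular values of a standard Gaussian matrix**: there are universal
constants `c, C > 0` such that for all `C ≤ k ≤ m`, an `m × k` matrix with i.i.d.
standard Gaussian entries satisfies `P{s_max(A) ≤ √m + c√k} ≤ 1/16` and
`P{s_min(A) ≥ √m − c√k} ≤ 1/16`. -/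
theorem gaussian_matrix_extreme_singular_values :
    ∃ c C : ℝ, 0 < c ∧ 0 < C ∧ ∀ k m : ℕ, C ≤ (k : ℝ) → k ≤ m →
      (Measure.pi fun _ : Fin m => Measure.pi fun _ : Fin k => gaussianReal 0 1)
          {f : Fin m → Fin k → ℝ |
            sMax (Matrix.of f) ≤ Real.sqrt m + c * Real.sqrt k} ≤ 1 / 16 ∧
      (Measure.pi fun _ : Fin m => Measure.pi fun _ : Fin k => gaussianReal 0 1)
          {f : Fin m → Fin k → ℝ |
            Real.sqrt m - c * Real.sqrt k ≤ sMin (Matrix.of f)} ≤ 1 / 16 := by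
  obtain ⟨C, hC64, hbound⟩ := exists_concentration_bound
  refine ⟨1 / 8, C, by norm_num, by linarith, fun k m hCk hkm => ?_⟩
  have hk64 : (64 : ℝ) ≤ k := hC64.trans hCk
  have hk2 : 2 ≤ k := by
    have : 64 ≤ k := by exact_mod_cast hk64
    omega
  obtain ⟨n, rfl⟩ : ∃ n, k = n + 2 := ⟨k - 2, by omega⟩
  obtain ⟨M, rfl⟩ : ∃ M, m = M + 1 := ⟨m - 1, by omega⟩
  set s := Real.sqrt (M + 1 : ℕ) with hs
  set t := Real.sqrt (n + 2 : ℕ) with ht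
  have hs2 : s ^ 2 = ((M + 1 : ℕ) : ℝ) := Real.sq_sqrt (Nat.cast_nonneg _)
  have ht2 : t ^ 2 = ((n + 2 : ℕ) : ℝ) := Real.sq_sqrt (Nat.cast_nonneg _)
  have ht0 : 0 < t := Real.sqrt_pos.2 (by linarith)
  have hts : t ≤ s := Real.sqrt_le_sqrt (by exact_mod_cast hkm)
  have hev := hbound M n hCk
  have hPhi := measurePreserving_alignedMatrix M n
  have key {a : Fin (M + 1) → ℝ} {r : Fin (n + 1) → ℝ} {H : Fin M → Fin (n + 1) → ℝ}
      (h : |a ⬝ᵥ a - ((M + 1 : ℕ) : ℝ)| < s * t / 16 ∧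
        |r ⬝ᵥ r - ((n + 1 : ℕ) : ℝ)| < ((n + 2 : ℕ) : ℝ) / 32 ∧
        |∑ i, H i 0 ^ 2 - (M : ℝ)| < s * t / 16) :
      0 < r ⬝ᵥ r ∧
      s + 1 / 8 * t <
        Real.sqrt (((Real.sqrt (a ⬝ᵥ a) + Real.sqrt (r ⬝ᵥ r)) ^ 2 + ∑ i, H i 0 ^ 2) / 2) ∧
      Real.sqrt (((Real.sqrt (a ⬝ᵥ a) - Real.sqrt (r ⬝ᵥ r)) ^ 2 + ∑ i, H i 0 ^ 2) / 2) <
        s - 1 / 8 * t := by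
    obtain ⟨h1, h2, h3⟩ := h
    have hn : ((n + 1 : ℕ) : ℝ) = t ^ 2 - 1 := by rw [ht2]; push_cast; ring
    have hM : (M : ℝ) = s ^ 2 - 1 := by rw [hs2]; push_cast; ring
    rw [← hs2] at h1
    rw [hn, ← ht2] at h2
    rw [hM] at h3
    rw [← ht2] at hk64
    refine ⟨?_, sqrt_bounds_of_concentration ht0 hts hk64 h1 h2 h3⟩
    linarith [(abs_lt.1 h2).1]
  constructor
  · rw [← hPhi.measure_preimage (measurableSet_sMax_le _ _ _).nullMeasurableSet]
    refine (measure_mono ?_).trans hev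
    rintro ⟨a, r, H⟩ hmem hgood
    obtain ⟨hr, hlow, -⟩ := key hgood
    obtain ⟨x, hx, hAx⟩ := exists_unit_mulVec_alignedMatrix a r H hr (one_pow 2)
    have h := (sMax_le_iff _ _).1 hmem x hx
    rw [hAx, one_mul] at h
    exact absurd h (not_le.2 hlow)
  · rw [← hPhi.measure_preimage (measurableSet_le_sMin _ _ _).nullMeasurableSet]
    refine (measure_mono ?_).trans hev
    rintro ⟨a, r, H⟩ hmem hgood
    obtain ⟨hr, -, hup⟩ := key hgood
    obtain ⟨x, hx, hAx⟩ := exists_unit_mulVec_alignedMatrix a r H hr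
      (show (-1 : ℝ) ^ 2 = 1 by norm_num)
    have h := (le_sMin_iff _ _).1 hmem x hx
    rw [hAx, neg_one_mul, ← sub_eq_add_neg] at h
    exact absurd h (not_le.2 hup)
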